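/- Let (A_i)_{i∈ℕ} be a directed system of commutative rings in which every transition map A_i → A_{i+1} is faithfully flat. Then the canonical map A_0 → colim_i A_i into the filtered colimit is faithfully flat. -/

import Mathlib

/-- A ring homomorphism `f : A →+* B` is faithfully flat if `B` is a faithfully flat `A`-module
via `f` (equivalently, `B` is `A`-flat and `Spec B → Spec A` is surjective). -/
def RingHom.IsFaithfullyFlat {A B : Type*} [CommRing A] [CommRing B] (f : A →+* B) : Prop :=
  letI : Algebra A B := f.toAlgebra
  Module.FaithfullyFlat A B

theorem aux_rel' {R S : Type*} [CommRing R] [CommRing S] [Algebra R S] [Module.Flat R S]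
    {l : ℕ} (f : Fin l → R) (x : Fin l → S) (h0 : ∑ i, algebraMap R S (f i) * x i = 0) :
    ∃ (k : ℕ) (a : Fin l → Fin k → R) (y : Fin k → S),
      (∀ i, x i = ∑ j, algebraMap R S (a i j) * y j) ∧ ∀ j, ∑ i, f i * a i j = 0 := by
  have h1 : ∑ i, f i • x i = 0 := by
    simpa only [Algebra.smul_def] using h0
  obtain ⟨n, a, z, h2, h3⟩ := Module.Flat.isTrivialRelation_of_sum_smul_eq_zero (R := R) (M := S) (f := f) (x := x) h1
  refine ⟨n, a, z, fun i => ?_, h3⟩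
  simpa only [Algebra.smul_def] using h2 i

theorem aux_rel {R S : Type*} [CommRing R] [CommRing S] (φ : R →+* S) (h : φ.Flat)
    {l : ℕ} (f : Fin l → R) (x : Fin l → S) (h0 : ∑ i, φ (f i) * x i = 0) :
    ∃ (k : ℕ) (a : Fin l → Fin k → R) (y : Fin k → S),
      (∀ i, x i = ∑ j, φ (a i j) * y j) ∧ ∀ j, ∑ i, f i * a i j = 0 :=
  letI : Algebra R S := φ.toAlgebra
  haveI : Module.Flat R S := h
  aux_rel' f x h0

theorem aux_comap {R S : Type*} [CommRing R] [CommRing S] (φ : R →+* S) (h : φ.FaithfullyFlat)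
    (I : Ideal R) : (I.map φ).comap φ = I := by
  algebraize [φ]
  exact Ideal.comap_map_eq_self_of_faithfullyFlat (B := S) I

/-- **Faithful flatness passes to filtered colimits of rings (tower case).**
Let `(A i)` be a directed system of commutative rings indexed by `ℕ` (presented by a functorial
family of transition maps `F`) whose one-step transition maps are all faithfully flat, and let
`C` together with the compatible maps `g i : A i →+* C` be its filtered colimit (every element
of `C` comes from some `A i`, and elements identified in `C` are identified at some finite
stage).  Then the canonical map `A 0 → C` is faithfully flat. -/
theorem stmt_3 {A : ℕ → Type*} [∀ i, CommRing (A i)]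
    (F : ∀ i j, i ≤ j → (A i →+* A j))
    (hFid : ∀ i, F i i le_rfl = RingHom.id (A i))
    (hFcomp : ∀ i j l (hij : i ≤ j) (hjl : j ≤ l),
      (F j l hjl).comp (F i j hij) = F i l (hij.trans hjl))
    (hflat : ∀ i, (F i (i + 1) (Nat.le_succ i)).IsFaithfullyFlat)
    {C : Type*} [CommRing C] (g : ∀ i, A i →+* C)
    (hg : ∀ i j (hij : i ≤ j), (g j).comp (F i j hij) = g i)
    (hjointly : ∀ c : C, ∃ i a, g i a = c)
    (heq : ∀ i (a b : A i), g i a = g i b → ∃ j, ∃ hij : i ≤ j, F i j hij a = F i j hij b) :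
    (g 0).IsFaithfullyFlat := by
  have hc : ∀ i j l (hij : i ≤ j) (hjl : j ≤ l) (a : A i),
      F j l hjl (F i j hij a) = F i l (hij.trans hjl) a := fun i j l hij hjl a =>
    RingHom.congr_fun (hFcomp i j l hij hjl) a
  have hgc : ∀ i j (hij : i ≤ j) (a : A i), g j (F i j hij a) = g i a := fun i j hij a =>
    RingHom.congr_fun (hg i j hij) a
  have hff : ∀ j, (F 0 j (Nat.zero_le j)).FaithfullyFlat := by
    intro j
    induction j with
    | zero =>
      rw [hFid 0]
      exact RingHom.FaithfullyFlat.of_bijective Function.bijective_id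
    | succ j ih =>
      rw [← hFcomp 0 j (j + 1) (Nat.zero_le j) (Nat.le_succ j)]
      exact RingHom.FaithfullyFlat.stableUnderComposition _ _ ih (hflat j)
  have hlift : ∀ (l : ℕ) (x : Fin l → C), ∃ j, ∃ y : Fin l → A j, ∀ i, g j (y i) = x i := by
    intro l x
    choose n a ha using fun i => hjointly (x i)
    refine ⟨Finset.univ.sup n, fun i => F (n i) _ (Finset.le_sup (Finset.mem_univ i)) (a i), ?_⟩
    intro i
    rw [hgc, ha]
  have hmem : ∀ (I : Ideal (A 0)) (c : C), c ∈ I.map (g 0) →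
      ∃ j, ∃ a ∈ I.map (F 0 j (Nat.zero_le j)), g j a = c := by
    intro I c hcI
    induction hcI using Submodule.span_induction with
    | mem x hx =>
      obtain ⟨r, hr, rfl⟩ := hx
      exact ⟨0, _, Ideal.mem_map_of_mem _ hr, hgc _ _ _ _⟩
    | zero => exact ⟨0, 0, zero_mem _, map_zero _⟩
    | add x y _ _ hx hy =>
      obtain ⟨j, a, ha, rfl⟩ := hx
      obtain ⟨k, b, hb, rfl⟩ := hy
      refine ⟨max j k, F j _ (le_max_left j k) a + F k _ (le_max_right j k) b,
        add_mem ?_ ?_, ?_⟩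
      · have := Ideal.mem_map_of_mem (F j _ (le_max_left j k)) ha
        rwa [Ideal.map_map, hFcomp] at this
      · have := Ideal.mem_map_of_mem (F k _ (le_max_right j k)) hb
        rwa [Ideal.map_map, hFcomp] at this
      · rw [map_add, hgc, hgc]
    | smul c x _ hx =>
      obtain ⟨j, a, ha, rfl⟩ := hx
      obtain ⟨k, b, rfl⟩ := hjointly c
      refine ⟨max j k, F k _ (le_max_right j k) b * F j _ (le_max_left j k) a,
        Ideal.mul_mem_left _ _ ?_, ?_⟩
      · have := Ideal.mem_map_of_mem (F j _ (le_max_left j k)) ha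
        rwa [Ideal.map_map, hFcomp] at this
      · rw [map_mul, hgc, hgc, smul_eq_mul]
  let algC : Algebra (A 0) C := (g 0).toAlgebra
  change Module.FaithfullyFlat (A 0) C
  have hsC : ∀ (r : A 0) (c : C), r • c = g 0 r * c := fun r c => rfl
  have hfl : Module.Flat (A 0) C := by
    refine Module.Flat.of_forall_isTrivialRelation ?_
    intro l f x hfx
    obtain ⟨j, y, hy⟩ := hlift l x
    have h0 : g j (∑ i, F 0 j (Nat.zero_le j) (f i) * y i) = g j 0 := by
      rw [map_sum, map_zero, ← hfx]
      refine Finset.sum_congr rfl fun i _ => ?_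
      rw [map_mul, hgc, hy, hsC]
    obtain ⟨k, hjk, hk⟩ := heq j _ _ h0
    have h1 : ∑ i, F 0 k (Nat.zero_le k) (f i) * F j k hjk (y i) = 0 := by
      rw [map_zero, map_sum] at hk
      rw [← hk]
      refine Finset.sum_congr rfl fun i _ => ?_
      rw [map_mul, hc]
    obtain ⟨n, a, z, h2, h3⟩ := aux_rel _ (hff k).flat f _ h1
    refine ⟨n, a, fun i => g k (z i), fun i => ?_, h3⟩
    rw [← hy i, ← hgc j k hjk, h2 i, map_sum]
    refine Finset.sum_congr rfl fun i _ => ?_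
    rw [hsC, map_mul, hgc]
  refine Module.FaithfullyFlat.mk ?_
  intro m hm htop
  have h1 : (1 : C) ∈ m.map (g 0) := by
    have h : (1 : C) ∈ m • (⊤ : Submodule (A 0) C) := by
      rw [htop]
      exact Submodule.mem_top
    rw [Ideal.smul_top_eq_map] at h
    exact h
  obtain ⟨j, a, ha, ha1⟩ := hmem m 1 h1
  obtain ⟨k, hjk, hk⟩ := heq j a 1 (by rw [ha1, map_one])
  have h2 := Ideal.mem_map_of_mem (F j k hjk) ha
  rw [Ideal.map_map, hFcomp, hk, map_one] at h2
  apply hm.ne_top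
  rw [← aux_comap _ (hff k) m, (Ideal.eq_top_iff_one _).mpr h2, Ideal.comap_top]
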